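/- arXiv:2603.11670 — 2 statements merged into one kernel-verified Lean document; each statement's English description precedes it below -/
import Mathlib

section
/- The associated tau sequence τ : ℤ → ℂ is a bilateral Somos-4 sequence: for every m ∈ ℤ, τ_{m+2}·τ_{m−2} = α·τ_{m+1}·τ_{m−1} + β·τ_m², where α := u² and β := u²·(v² + f). -/
open PowerSeries in
/-- The `k × k` Hankel determinant of the coefficients of a power series. -/
noncomputable def hankelDet {K : Type*} [Field K] (P : PowerSeries K) (k : ℕ) : K :=
  (Matrix.of fun i j : Fin k => coeff ((i : ℕ) + (j : ℕ)) P).det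

/-- The power series obtained by dropping the first `j` coefficients. -/
noncomputable def coeffShift {K : Type*} [Field K] (P : PowerSeries K) (j : ℕ) : PowerSeries K :=
  PowerSeries.mk fun i => PowerSeries.coeff (i + j) P

section Hankel

open PowerSeries

variable {K : Type*} [Field K]

lemma coeffShift_zero (P : PowerSeries K) : coeffShift P 0 = P := by
  ext i; simp [coeffShift]

lemma X_mul_coeffShift_succ (P : PowerSeries K) (j : ℕ) :
    X * coeffShift P (j + 1) = coeffShift P j - C (coeff j P) := by
  ext i
  cases i with
  | zero => simp [coeffShift]
  | succ i =>
    rw [mul_comm, coeff_succ_mul_X]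
    simp [coeffShift]
    congr 2; ring

lemma coeff_recurrence_of_mul_eq_one {P Q : PowerSeries K} {a b : K}
    (h : P * (C a + C b * X + X ^ 2 * Q) = 1) (j : ℕ) :
    a * coeff (j + 1) P + b * coeff j P +
      ∑ l ∈ Finset.range j, coeff l Q * coeff (j - 1 - l) P = 0 := by
  have h1 := congrArg (coeff (j + 1)) h
  have e : P * (C a + C b * X + X ^ 2 * Q) =
      C a * P + C b * P * X + (Q * P) * X * X := by ring
  rw [e, map_add, map_add, coeff_succ_mul_X, coeff_succ_mul_X, coeff_C_mul, coeff_C_mul] at h1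
  simp only [coeff_one, Nat.succ_ne_zero, if_false] at h1
  cases j with
  | zero => simpa using h1
  | succ j =>
    rw [coeff_succ_mul_X, coeff_mul, Finset.Nat.sum_antidiagonal_eq_sum_range_succ
      (fun x y => coeff x Q * coeff y P)] at h1
    simpa using h1

lemma coeffShift_eq_of_mul_eq_one {P Q : PowerSeries K} {a b : K}
    (h : P * (C a + C b * X + X ^ 2 * Q) = 1) (j : ℕ) :
    coeffShift P j = P * (C (a * coeff j P) -
      X * ∑ l ∈ Finset.range j, coeffShift Q l * C (coeff (j - 1 - l) P)) := by
  induction j with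
  | zero =>
    have h0 : a * coeff 0 P = 1 := by
      have := congrArg (coeff 0) h
      simp only [coeff_zero_eq_constantCoeff] at this ⊢
      simpa [mul_comm] using this
    rw [h0, coeffShift_zero]; simp
  | succ j ih =>
    apply mul_left_cancel₀ (X_ne_zero (R := K))
    rw [X_mul_coeffShift_succ, ih, Finset.sum_range_succ', coeffShift_zero]
    have hr := congrArg (C (R := K)) (coeff_recurrence_of_mul_eq_one h j)
    have hs : X * ∑ l ∈ Finset.range j, coeffShift Q (l + 1) * C (coeff (j + 1 - 1 - (l + 1)) P)
        = ∑ l ∈ Finset.range j, coeffShift Q l * C (coeff (j - 1 - l) P)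
          - C (∑ l ∈ Finset.range j, coeff l Q * coeff (j - 1 - l) P) := by
      rw [Finset.mul_sum, map_sum, ← Finset.sum_sub_distrib]
      refine Finset.sum_congr rfl fun l _ => ?_
      rw [← mul_assoc, X_mul_coeffShift_succ, map_mul,
        show j + 1 - 1 - (l + 1) = j - 1 - l by omega]
      ring
    simp only [map_add, map_mul, map_zero] at hr
    simp only [Nat.add_sub_cancel, Nat.sub_zero, map_mul] at hs ⊢
    linear_combination (C (coeff j P)) * h + X * P * hs - X * P * hr

/-- Entries of the middle factor in the triangular factorization of a Hankel matrix. -/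
noncomputable def hankelStep (a : K) (Q : PowerSeries K) : ℕ → ℕ → K
  | 0, 0 => a
  | i + 1, j + 1 => -coeff (i + j) Q
  | _, _ => 0

lemma coeff_add_eq_sum_hankelStep {P Q : PowerSeries K} {a b : K}
    (h : P * (C a + C b * X + X ^ 2 * Q) = 1) (i j : ℕ) :
    coeff (i + j) P = ∑ r ∈ Finset.range (i + 1), ∑ l ∈ Finset.range (j + 1),
      coeff (i - r) P * hankelStep a Q r l * coeff (j - l) P := by
  have key : C (a * coeff j P) -
      X * ∑ l ∈ Finset.range j, coeffShift Q l * C (coeff (j - 1 - l) P) =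
      PowerSeries.mk fun r => ∑ l ∈ Finset.range (j + 1), hankelStep a Q r l * coeff (j - l) P := by
    ext r
    rw [coeff_mk, Finset.sum_range_succ', map_sub, mul_comm X]
    cases r with
    | zero => simp [hankelStep]
    | succ r =>
      rw [coeff_succ_mul_X, map_sum]
      simp only [coeff_mul_C]
      simp only [hankelStep, coeffShift, coeff_mk, coeff_C, Nat.succ_ne_zero, if_false,
        zero_mul, add_zero, zero_sub, ← Finset.sum_neg_distrib, neg_mul]
      refine Finset.sum_congr rfl fun l _ => ?_
      rw [show j - (l + 1) = j - 1 - l by omega]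
  have h1 := congrArg (coeff i) (coeffShift_eq_of_mul_eq_one h j)
  rw [key, mul_comm P, coeff_mul, Finset.Nat.sum_antidiagonal_eq_sum_range_succ
    (fun x y => coeff x (PowerSeries.mk fun r =>
      ∑ l ∈ Finset.range (j + 1), hankelStep a Q r l * coeff (j - l) P) * coeff y P)] at h1
  simp only [coeffShift, coeff_mk] at h1
  rw [h1]
  refine Finset.sum_congr rfl fun r _ => ?_
  rw [Finset.sum_mul]
  exact Finset.sum_congr rfl fun l _ => by ring

lemma sum_range_succ_eq_sum_fin_ite {k i : ℕ} (hi : i < k) (g : ℕ → K) :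
    ∑ r ∈ Finset.range (i + 1), g r = ∑ r : Fin k, if (r : ℕ) ≤ i then g r else 0 := by
  rw [Fin.sum_univ_eq_sum_range (fun r => if r ≤ i then g r else 0) k, ← Finset.sum_filter]
  refine Finset.sum_congr ?_ fun _ _ => rfl
  ext r; simp; omega

lemma hankelDet_zero (P : PowerSeries K) : hankelDet P 0 = 1 := by
  simp [hankelDet]

lemma hankelDet_succ {P Q : PowerSeries K} {a b : K}
    (h : P * (C a + C b * X + X ^ 2 * Q) = 1) (k : ℕ) :
    hankelDet P (k + 1) = (coeff 0 P) ^ (k + 1) * (a * ((-1) ^ k * hankelDet Q k)) *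
      (coeff 0 P) ^ (k + 1) := by
  let L : Matrix (Fin (k + 1)) (Fin (k + 1)) K :=
    Matrix.of fun i r => if (r : ℕ) ≤ i then coeff ((i : ℕ) - r) P else 0
  let M : Matrix (Fin (k + 1)) (Fin (k + 1)) K :=
    Matrix.of fun r l => hankelStep a Q r l
  have hL : L.det = (coeff 0 P) ^ (k + 1) := by
    rw [Matrix.det_of_isLowerTriangular L fun i j hij => if_neg (not_le.mpr hij)]
    simp [L]
  have hM : M.det = a * ((-1) ^ k * hankelDet Q k) := by
    rw [Matrix.det_succ_row_zero, Fin.sum_univ_succ]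
    have : M.submatrix Fin.succ (Fin.succAbove 0) =
        -Matrix.of fun i j : Fin k => coeff ((i : ℕ) + (j : ℕ)) Q := by
      ext i j; simp [M, hankelStep]
    rw [this, Matrix.det_neg]
    simp [M, hankelStep, hankelDet]
  have hfac : (Matrix.of fun i j : Fin (k + 1) => coeff ((i : ℕ) + (j : ℕ)) P) =
      L * M * L.transpose := by
    ext i j
    rw [Matrix.of_apply, coeff_add_eq_sum_hankelStep h, Matrix.mul_assoc, Matrix.mul_apply,
      sum_range_succ_eq_sum_fin_ite i.2]
    refine Finset.sum_congr rfl fun r _ => ?_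
    rw [Matrix.mul_apply, sum_range_succ_eq_sum_fin_ite j.2, Finset.mul_sum]
    simp only [L, M, Matrix.transpose_apply, Matrix.of_apply]
    split_ifs
    · refine Finset.sum_congr rfl fun l _ => ?_
      split_ifs <;> ring
    · simp
  rw [hankelDet, hfac, Matrix.det_mul, Matrix.det_mul, Matrix.det_transpose, hL, hM]

lemma hankelDet_mul_hankelDet {P : ℕ → PowerSeries K} {a b : ℕ → K}
    (h : ∀ j, P j * (C (a j) + C (b j) * X + X ^ 2 * P (j + 1)) = 1) (k j : ℕ) :
    hankelDet (P j) (k + 2) * hankelDet (P j) k * (a (j + k) * a (j + k + 1)) =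
      -(hankelDet (P j) (k + 1)) ^ 2 := by
  have h0 (j : ℕ) : a j * coeff 0 (P j) = 1 := by
    have := congrArg (coeff 0) (h j)
    simp only [coeff_zero_eq_constantCoeff] at this ⊢
    simpa [mul_comm] using this
  induction k generalizing j with
  | zero =>
    simp only [hankelDet_succ (h _), hankelDet_zero, Nat.add_zero]
    generalize coeff 0 (P j) = x at *
    have e2 := h0 (j + 1)
    linear_combination (-x ^ 4 * a j ^ 2 * (coeff 0 (P (j + 1)) * a (j + 1) + 1)) * e2
  | succ k ih =>
    have ih := ih (j + 1)
    rw [show j + 1 + k = j + (k + 1) by omega] at ih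
    rw [hankelDet_succ (h j) (k + 2), hankelDet_succ (h j) k, hankelDet_succ (h j) (k + 1)]
    generalize coeff 0 (P j) = x at *
    linear_combination (x ^ (k + 3) * x ^ (k + 1) * a j * (-1) ^ k) ^ 2 * ih

end Hankel

section Laurent

open PowerSeries

lemma exists_powerSeries_of_sq_eq {K : Type*} [Field K] {Y : LaurentSeries K} {f c e : K}
    (hY : Y ^ 2 = ((HahnSeries.single (-2 : ℤ) (1 : K) : LaurentSeries K) + HahnSeries.C f) ^ 2 +
        HahnSeries.C c *
          ((HahnSeries.single (-1 : ℤ) (1 : K) : LaurentSeries K) - HahnSeries.C e))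
    (hYnorm : ((HahnSeries.single (2 : ℤ) (1 : K) : LaurentSeries K) * Y).coeff 0 = 1) :
    ∃ w : PowerSeries K, HahnSeries.single (2 : ℤ) (1 : K) * Y = HahnSeries.ofPowerSeries ℤ K w ∧
      constantCoeff w = 1 ∧
      w ^ 2 = (1 + C f * X ^ 2) ^ 2 + C c * (X ^ 3 - C e * X ^ 4) := by
  have h2 : (HahnSeries.single (2 : ℤ) (1 : K) : LaurentSeries K) =
      (HahnSeries.single (1 : ℤ) (1 : K)) ^ 2 := by
    simp
  have h1 : (HahnSeries.single (1 : ℤ) (1 : K) : LaurentSeries K) *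
      HahnSeries.single (-1 : ℤ) (1 : K) = 1 := by
    simp
  have hn2 : (HahnSeries.single (-2 : ℤ) (1 : K) : LaurentSeries K) =
      (HahnSeries.single (-1 : ℤ) (1 : K)) ^ 2 := by
    simp
  have hsq : (HahnSeries.single (2 : ℤ) (1 : K) * Y) ^ 2 = HahnSeries.ofPowerSeries ℤ K
      ((1 + C f * X ^ 2) ^ 2 + C c * (X ^ 3 - C e * X ^ 4)) := by
    simp only [map_add, map_mul, map_sub, map_pow, map_one, HahnSeries.ofPowerSeries_C,
      HahnSeries.ofPowerSeries_X]
    rw [mul_pow, hY, h2, hn2]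
    generalize (HahnSeries.single (1 : ℤ) (1 : K) : LaurentSeries K) = t at *
    generalize (HahnSeries.single (-1 : ℤ) (1 : K) : LaurentSeries K) = x at *
    obtain rfl : x = t⁻¹ := eq_inv_of_mul_eq_one_right h1
    have ht : t ≠ 0 := left_ne_zero_of_mul_eq_one h1
    field_simp
  obtain ⟨w, hw⟩ := IsIntegrallyClosed.exists_algebraMap_eq_of_isIntegral_pow
    (R := PowerSeries K) (K := LaurentSeries K) (n := 2)
    (x := HahnSeries.single (2 : ℤ) (1 : K) * Y) two_pos
    (by rw [hsq, ← LaurentSeries.coe_algebraMap]; exact isIntegral_algebraMap)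
  rw [LaurentSeries.coe_algebraMap] at hw
  refine ⟨w, hw.symm, ?_, ?_⟩
  · rw [← hw] at hYnorm
    rw [← hYnorm, ← coeff_zero_eq_constantCoeff_apply]
    exact (HahnSeries.ofPowerSeries_apply_coeff (Γ := ℤ) w 0).symm
  · rw [← hw, ← map_pow] at hsq
    exact HahnSeries.ofPowerSeries_injective hsq

/-- Expansion at infinity of the shifted reciprocal of a quadratic irrational
`(Y + x² + g) / (κ (x - e))`, where `w` is the expansion of `Y / x²`. -/
noncomputable def recipSeries {K : Type*} [Field K] (w : PowerSeries K) (g κ e : K) :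
    PowerSeries K :=
  C κ * (1 - C e * X) * (w + 1 + C g * X ^ 2)⁻¹

lemma constantCoeff_recip_den {K : Type*} [Field K] [CharZero K] {w : PowerSeries K}
    (hw : constantCoeff w = 1) (g : K) : constantCoeff (w + 1 + C g * X ^ 2) ≠ 0 := by
  simp [hw, one_add_one_eq_two]

lemma coeff_inv_quadratic {K : Type*} [Field K] [CharZero K] {Y : LaurentSeries K}
    {w : PowerSeries K}
    (hYw : HahnSeries.single (2 : ℤ) (1 : K) * Y = HahnSeries.ofPowerSeries ℤ K w)
    (hw : constantCoeff w = 1) (f g κ e : K) (k : ℕ) :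
    (((Y + HahnSeries.single (-2 : ℤ) (1 : K) + HahnSeries.C f + HahnSeries.C g) /
        (HahnSeries.C κ * (HahnSeries.single (-1 : ℤ) (1 : K) - HahnSeries.C e)))⁻¹).coeff
          ((k : ℤ) + 1) = coeff k (recipSeries w (f + g) κ e) := by
  have hinv := PowerSeries.mul_inv_cancel _ (constantCoeff_recip_den hw (f + g))
  have hlaurent := congrArg (HahnSeries.ofPowerSeries ℤ K) hinv
  have key : ((Y + HahnSeries.single (-2 : ℤ) (1 : K) + HahnSeries.C f + HahnSeries.C g) /
        (HahnSeries.C κ * (HahnSeries.single (-1 : ℤ) (1 : K) - HahnSeries.C e)))⁻¹ =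
      HahnSeries.single (1 : ℤ) (1 : K) *
        HahnSeries.ofPowerSeries ℤ K (recipSeries w (f + g) κ e) := by
    have h1 : (HahnSeries.single (1 : ℤ) (1 : K) : LaurentSeries K) *
        HahnSeries.single (-1 : ℤ) (1 : K) = 1 := by
      simp
    have h2 : (HahnSeries.single (2 : ℤ) (1 : K) : LaurentSeries K) =
        (HahnSeries.single (1 : ℤ) (1 : K)) ^ 2 := by
      simp
    have hn2 : (HahnSeries.single (-2 : ℤ) (1 : K) : LaurentSeries K) =
        (HahnSeries.single (-1 : ℤ) (1 : K)) ^ 2 := by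
      simp
    rw [recipSeries]
    simp only [map_add, map_mul, map_sub, map_pow, map_one, HahnSeries.ofPowerSeries_C,
      HahnSeries.ofPowerSeries_X] at hlaurent ⊢
    rw [← hYw, h2] at hlaurent
    rw [hn2, inv_div]
    generalize HahnSeries.ofPowerSeries ℤ K (w + 1 + (C f + C g) * X ^ 2)⁻¹ = i at *
    generalize (HahnSeries.single (1 : ℤ) (1 : K) : LaurentSeries K) = t at *
    generalize (HahnSeries.single (-1 : ℤ) (1 : K) : LaurentSeries K) = x at *
    have hD : (Y + x ^ 2 + HahnSeries.C f + HahnSeries.C g) * (t ^ 2 * i) = 1 := by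
      rw [← hlaurent]
      linear_combination i * (t * x + 1) * h1
    rw [div_eq_iff (left_ne_zero_of_mul_eq_one hD)]
    linear_combination (-HahnSeries.C κ * (x - HahnSeries.C e)) * hD +
      HahnSeries.C κ * t * i * (Y + x ^ 2 + HahnSeries.C f + HahnSeries.C g) * h1
  rw [key, HahnSeries.coeff_single_mul_add, one_mul]
  exact HahnSeries.ofPowerSeries_apply_coeff (Γ := ℤ) _ k

lemma coeff_neg_inv_quadratic {K : Type*} [Field K] [CharZero K] {Y : LaurentSeries K}
    {w : PowerSeries K}
    (hYw : HahnSeries.single (2 : ℤ) (1 : K) * Y = HahnSeries.ofPowerSeries ℤ K w)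
    (hw : constantCoeff w = 1) (f g κ e : K) (k : ℕ) :
    (-((Y + HahnSeries.single (-2 : ℤ) (1 : K) + HahnSeries.C f + HahnSeries.C g) /
        (HahnSeries.C κ * (HahnSeries.single (-1 : ℤ) (1 : K) - HahnSeries.C e)))⁻¹).coeff
          ((k : ℤ) + 1) = coeff k (recipSeries w (f + g) (-κ) e) := by
  rw [HahnSeries.coeff_neg, coeff_inv_quadratic hYw hw, recipSeries, recipSeries, map_neg,
    neg_mul, neg_mul, map_neg]

lemma hankelDet_one_recipSeries {K : Type*} [Field K] {w : PowerSeries K}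
    (hw : constantCoeff w = 1) (g κ e : K) : hankelDet (recipSeries w g κ e) 1 = κ / 2 := by
  simp [hankelDet, recipSeries, hw, one_add_one_eq_two, div_eq_mul_inv]

lemma recipSeries_mul_eq_one {K : Type*} [Field K] [CharZero K] {w : PowerSeries K}
    (hw : constantCoeff w = 1) {f c e₀ : K}
    (hw2 : w ^ 2 = (1 + C f * X ^ 2) ^ 2 + C c * (X ^ 3 - C e₀ * X ^ 4))
    {d d' κ κ' e e' : K} (hκ : κ ≠ 0) (hκκ : κ * κ' = -4 * d')
    (hd : d' = -d - e ^ 2 - f) (hsum : 4 * d' * (e + e') = c)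
    (hprod : d' ^ 2 + f * d' - d' * e * e' = -(c * e₀) / 4) :
    recipSeries w (f + 2 * d) κ e *
      (C (2 / κ) + C (2 / κ * e) * X + X ^ 2 * recipSeries w (f + 2 * d') κ' e') = 1 := by
  have h1 := PowerSeries.mul_inv_cancel _ (constantCoeff_recip_den hw (f + 2 * d))
  have h2 := PowerSeries.mul_inv_cancel _ (constantCoeff_recip_den hw (f + 2 * d'))
  have hk1 : C κ * C (2 / κ) = (2 : PowerSeries K) := by
    rw [← map_mul, mul_div_cancel₀ _ hκ, map_ofNat]
  have hk2 := congrArg (C (R := K)) hκκ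
  have hd := congrArg (C (R := K)) hd
  have hsum := congrArg (C (R := K)) hsum
  have hprod : C (4 * (d' ^ 2 + f * d' - d' * e * e')) = C (-(c * e₀)) := by
    rw [hprod]
    congr 1
    ring
  rw [recipSeries, recipSeries]
  generalize (w + 1 + C (f + 2 * d) * X ^ 2)⁻¹ = i at *
  generalize (w + 1 + C (f + 2 * d') * X ^ 2)⁻¹ = i' at *
  simp only [map_add, map_sub, map_mul, map_neg, map_pow, map_ofNat] at *
  have hden : 2 * (1 - C e ^ 2 * X ^ 2) * (w + 1 + (C f + 2 * C d') * X ^ 2) -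
      4 * C d' * X ^ 2 * (1 - C e * X) * (1 - C e' * X) =
      (w + 1 + (C f + 2 * C d) * X ^ 2) * (w + 1 + (C f + 2 * C d') * X ^ 2) := by
    linear_combination -hw2 + X ^ 3 * hsum + X ^ 4 * hprod -
      2 * X ^ 2 * (w + 1 + (C f + 2 * C d') * X ^ 2) * hd
  linear_combination i * (1 - C e ^ 2 * X ^ 2) * hk1 +
    X ^ 2 * (1 - C e * X) * (1 - C e' * X) * i * i' * hk2 -
    2 * (1 - C e ^ 2 * X ^ 2) * i * h2 + i * i' * hden +
    (w + 1 + (C f + 2 * C d') * X ^ 2) * i' * h1 + h2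

lemma hankelDet_recipSeries_recurrence {K : Type*} [Field K] [CharZero K] {w : PowerSeries K}
    (hw : constantCoeff w = 1) {f c e₀ : K}
    (hw2 : w ^ 2 = (1 + C f * X ^ 2) ^ 2 + C c * (X ^ 3 - C e₀ * X ^ 4))
    {d κ e : ℕ → K} (hκ : ∀ j, κ j ≠ 0) (hκκ : ∀ j, κ j * κ (j + 1) = -4 * d (j + 1))
    (hd : ∀ j, d (j + 1) = -d j - e j ^ 2 - f)
    (hsum : ∀ j, 4 * d (j + 1) * (e j + e (j + 1)) = c)
    (hprod : ∀ j, d (j + 1) ^ 2 + f * d (j + 1) - d (j + 1) * e j * e (j + 1) = -(c * e₀) / 4)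
    (k : ℕ) :
    hankelDet (recipSeries w (f + 2 * d 0) (κ 0) (e 0)) (k + 2) *
        hankelDet (recipSeries w (f + 2 * d 0) (κ 0) (e 0)) k =
      d (k + 1) * hankelDet (recipSeries w (f + 2 * d 0) (κ 0) (e 0)) (k + 1) ^ 2 := by
  have h := hankelDet_mul_hankelDet
    (P := fun j => recipSeries w (f + 2 * d j) (κ j) (e j))
    (fun j => recipSeries_mul_eq_one hw hw2 (hκ j) (hκκ j) (hd j) (hsum j) (hprod j)) k 0
  have ha := hκ k
  have hb := hκ (k + 1)
  simp only [zero_add] at h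
  generalize recipSeries w (f + 2 * d 0) (κ 0) (e 0) = P at *
  field_simp at h
  linear_combination h / 4 - hankelDet P (k + 1) ^ 2 / 4 * hκκ k

end Laurent



/-- Corollary 4.2 of the paper: the associated tau sequence of `Y_n` is a
bilateral Somos-4 sequence with coefficients `α = u²` and `β = u²(v²+f)`. -/
theorem tau_is_bilateral_somos4
    (f u v : ℂ) (d vv uu : ℤ → ℂ) (Y : LaurentSeries ℂ)
    (hns : ¬ ∃ p : Polynomial ℂ,
      (Polynomial.X ^ 2 + Polynomial.C f) ^ 2 +
        Polynomial.C (4 * u) * (Polynomial.X - Polynomial.C v) = p ^ 2)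
    (hY : Y ^ 2 =
      ((HahnSeries.single (-2 : ℤ) (1 : ℂ) : LaurentSeries ℂ) + HahnSeries.C f) ^ 2 +
        HahnSeries.C (4 * u) *
          ((HahnSeries.single (-1 : ℤ) (1 : ℂ) : LaurentSeries ℂ) - HahnSeries.C v))
    (hYnorm : ((HahnSeries.single (2 : ℤ) (1 : ℂ) : LaurentSeries ℂ) * Y).coeff 0 = 1)
    (hd0 : ∀ n : ℤ, d n ≠ 0)
    (hdrec : ∀ n : ℤ, d (n + 1) = -d n - (vv n) ^ 2 - f)
    (hvrec : ∀ n : ℤ, vv (n + 1) = u / d (n + 1) - vv n)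
    (hH : ∀ n : ℤ, (d n) ^ 2 + f * d n + d n * (vv n) ^ 2 - u * vv n = -(u * v))
    (hu0 : ∀ n : ℤ, uu n ≠ 0)
    (hurec : ∀ n : ℤ, uu n * uu (n - 1) = -4 * d n)
    (Yseq Ytil Ystar aseq : ℤ → LaurentSeries ℂ)
    (hYseq : ∀ n : ℤ, Yseq n =
      (Y + HahnSeries.single (-2 : ℤ) (1 : ℂ) + HahnSeries.C f + HahnSeries.C (2 * d n)) /
        (HahnSeries.C (uu n) *
          (HahnSeries.single (-1 : ℤ) (1 : ℂ) - HahnSeries.C (vv n))))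
    (hYtil : ∀ n : ℤ, Ytil n =
      (Y + HahnSeries.single (-2 : ℤ) (1 : ℂ) + HahnSeries.C f + HahnSeries.C (2 * d n)) /
        (HahnSeries.C (uu (n - 1)) *
          (HahnSeries.single (-1 : ℤ) (1 : ℂ) - HahnSeries.C (vv (n - 1)))))
    (hYstar : ∀ n : ℤ, Ystar n =
      (-Y + HahnSeries.single (-2 : ℤ) (1 : ℂ) + HahnSeries.C f + HahnSeries.C (2 * d n)) /
        (HahnSeries.C (uu n) *
          (HahnSeries.single (-1 : ℤ) (1 : ℂ) - HahnSeries.C (vv n))))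
    (haseq : ∀ n : ℤ, aseq n =
      HahnSeries.C (2 / uu n) *
        (HahnSeries.single (-1 : ℤ) (1 : ℂ) + HahnSeries.C (vv n)))
    (n : ℤ) (s st : ℕ → ℂ) (τ : ℤ → ℂ)
    (hs : ∀ k : ℕ, s k = ((Yseq n)⁻¹).coeff ((k : ℤ) + 1))
    (hst : ∀ k : ℕ, st k = (-(Ytil n)⁻¹).coeff ((k : ℤ) + 1))
    (hτn : τ n = 1)
    (hτpos : ∀ k : ℕ, 1 ≤ k →
      τ (n + k) = Matrix.det (fun i j : Fin k => s (i + j)))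
    (hτneg : ∀ k : ℕ, 1 ≤ k →
      τ (n - k) = Matrix.det (fun i j : Fin k => st (i + j)))
    :
    ∀ m : ℤ, τ (m + 2) * τ (m - 2) =
      u ^ 2 * τ (m + 1) * τ (m - 1) + u ^ 2 * (v ^ 2 + f) * (τ m) ^ 2 := by
  obtain ⟨w, hYw, hw, hw2⟩ := exists_powerSeries_of_sq_eq hY hYnorm
  have hsum (m : ℤ) : d (m + 1) * (vv m + vv (m + 1)) = u := by
    rw [hvrec m]
    field_simp [hd0 (m + 1)]
    ring
  have hprod (m : ℤ) : d (m + 1) ^ 2 + f * d (m + 1) - d (m + 1) * vv m * vv (m + 1) = -(u * v) := by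
    linear_combination hH (m + 1) - vv (m + 1) * hsum m
  have hpos : ∀ k : ℕ, τ (n + k) =
      hankelDet (recipSeries w (f + 2 * d n) (uu n) (vv n)) k := by
    intro k
    cases k with
    | zero => simpa [hankelDet_zero] using hτn
    | succ k =>
      rw [hτpos _ k.succ_pos, hankelDet]
      congr 1
      ext i j
      rw [Matrix.of_apply, hs, hYseq]
      exact_mod_cast coeff_inv_quadratic hYw hw f (2 * d n) (uu n) (vv n) (i + j)
  have hneg : ∀ k : ℕ, τ (n - k) =
      hankelDet (recipSeries w (f + 2 * d n) (-uu (n - 1)) (vv (n - 1))) k := by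
    intro k
    cases k with
    | zero => simpa [hankelDet_zero] using hτn
    | succ k =>
      rw [hτneg _ k.succ_pos, hankelDet]
      congr 1
      ext i j
      rw [Matrix.of_apply, hst, hYtil]
      exact_mod_cast coeff_neg_inv_quadratic hYw hw f (2 * d n) (uu (n - 1)) (vv (n - 1)) (i + j)
  have hup (k : ℕ) : τ (n + k + 2) * τ (n + k) = d (n + k + 1) * τ (n + k + 1) ^ 2 := by
    have h := hankelDet_recipSeries_recurrence hw hw2
      (d := fun j : ℕ => d (n + j)) (κ := fun j : ℕ => uu (n + j)) (e := fun j : ℕ => vv (n + j))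
      (fun j => hu0 _)
      (fun j => by
        have := hurec (n + j + 1)
        rw [add_sub_cancel_right, mul_comm] at this
        simpa only [Nat.cast_succ, ← add_assoc] using this)
      (fun j => by simpa only [Nat.cast_succ, ← add_assoc] using hdrec (n + j))
      (fun j => by
        simp only [Nat.cast_succ, ← add_assoc]
        linear_combination 4 * hsum (n + j))
      (fun j => by
        simp only [Nat.cast_succ, ← add_assoc]
        linear_combination hprod (n + j)) k
    simp only [Nat.cast_zero, add_zero] at h
    simp only [← hpos] at h
    simpa only [Nat.cast_add, Nat.cast_one, Nat.cast_ofNat, ← add_assoc] using h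
  have hdown (k : ℕ) : τ (n - k - 2) * τ (n - k) = d (n - k - 1) * τ (n - k - 1) ^ 2 := by
    have h := hankelDet_recipSeries_recurrence hw hw2
      (d := fun j : ℕ => d (n - j)) (κ := fun j : ℕ => -uu (n - 1 - j))
      (e := fun j : ℕ => vv (n - 1 - j))
      (fun j => neg_ne_zero.mpr (hu0 _))
      (fun j => by
        have := hurec (n - 1 - j)
        simp only [Nat.cast_succ, ← sub_sub, sub_right_comm _ (1 : ℤ)] at this ⊢
        linear_combination this)
      (fun j => by
        have := hdrec (n - j - 1)
        simp only [Nat.cast_succ, ← sub_sub, sub_right_comm _ (1 : ℤ), sub_add_cancel] at this ⊢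
        linear_combination this)
      (fun j => by
        have := hsum (n - j - 1 - 1)
        simp only [Nat.cast_succ, ← sub_sub, sub_right_comm _ (1 : ℤ), sub_add_cancel] at this ⊢
        linear_combination 4 * this)
      (fun j => by
        have := hprod (n - j - 1 - 1)
        simp only [Nat.cast_succ, ← sub_sub, sub_right_comm _ (1 : ℤ), sub_add_cancel] at this ⊢
        linear_combination this) k
    simp only [Nat.cast_zero, sub_zero] at h
    simp only [← hneg] at h
    simpa only [Nat.cast_add, Nat.cast_one, Nat.cast_ofNat, ← sub_sub] using h
  have hmid : τ (n + 1) * τ (n - 1) = d n := by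
    have e1 := hpos 1
    have e2 := hneg 1
    rw [hankelDet_one_recipSeries hw, Nat.cast_one] at e1 e2
    rw [e1, e2]
    linear_combination -hurec n / 4
  have hrec (m : ℤ) : τ (m + 1) * τ (m - 1) = d m * τ m ^ 2 := by
    rcases lt_trichotomy m n with hm | rfl | hm
    · obtain ⟨k, rfl⟩ : ∃ k : ℕ, m = n - k - 1 := ⟨(n - m - 1).toNat, by omega⟩
      rw [← hdown k, sub_add_cancel, sub_sub _ 1 1, one_add_one_eq_two, mul_comm]
    · simp [hmid, hτn]
    · obtain ⟨k, rfl⟩ : ∃ k : ℕ, m = n + k + 1 := ⟨(m - n - 1).toNat, by omega⟩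
      rw [← hup k, add_sub_cancel_right, add_assoc _ 1 1, one_add_one_eq_two]
  have hne (m : ℤ) : τ m ≠ 0 := by
    induction m using Int.inductionOn' (b := n) with
    | zero => simp [hτn]
    | succ k _ ih =>
      exact left_ne_zero_of_mul (hrec k ▸ mul_ne_zero (hd0 k) (pow_ne_zero 2 ih))
    | pred k _ ih =>
      exact right_ne_zero_of_mul (hrec k ▸ mul_ne_zero (hd0 k) (pow_ne_zero 2 ih))
  intro m
  have h0 := hrec m
  have h1 := hrec (m + 1)
  have h2 := hrec (m - 1)
  have hs := hsum (m - 1)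
  have hp := hprod (m - 1)
  have hd1 := hdrec m
  have hd2 := hdrec (m - 1)
  simp only [sub_add_cancel, add_sub_cancel_right, add_assoc, sub_sub, one_add_one_eq_two]
    at h0 h1 h2 hs hp hd1 hd2
  have hA : d (m + 1) * d m = u * (v - vv m) := by
    linear_combination d m * hd1 - hH m
  have hB : d m * d (m - 1) = u * (v - vv (m - 1)) := by
    linear_combination d (m - 1) * hd2 - hH (m - 1)
  have hE : d (m + 1) * d m * (d m * d (m - 1)) = u ^ 2 * (d m + v ^ 2 + f) := by
    rw [hA, hB]
    apply mul_left_cancel₀ (hd0 m)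
    linear_combination -u ^ 2 * v * hs - u ^ 2 * hp
  apply mul_left_cancel₀ (pow_ne_zero 2 (hne m))
  calc τ m ^ 2 * (τ (m + 2) * τ (m - 2))
      = d (m + 1) * d (m - 1) * (τ (m + 1) * τ (m - 1)) ^ 2 := by
        linear_combination τ m * τ (m - 2) * h1 + d (m + 1) * τ (m + 1) ^ 2 * h2
    _ = τ m ^ 2 * (u ^ 2 * τ (m + 1) * τ (m - 1) + u ^ 2 * (v ^ 2 + f) * τ m ^ 2) := by
        rw [mul_assoc (u ^ 2), h0]
        linear_combination τ m ^ 4 * hE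
end

section
/- For every n ∈ ℤ: (i) Ỹ_{n−1} ≠ 0, the backward continued-fraction step Ỹ_n = a_{n−1}(t⁻¹) + (Ỹ_{n−1})⁻¹ holds in ℂ((t)), and Ỹ_n − a_{n−1}(t⁻¹) has t-adic order ≥ 1 (so the polynomial part of Ỹ_n equals a_{n−1}, and Ỹ_n = ⟨a_{n−1}, a_{n−2}, …⟩); and (ii) Ỹ_n · Y_n* = −1 in ℂ((t)), i.e. (Y_n, Ỹ_n) is a quadratic orthogonal pair, where Y_n* := (−Y + P_n(t⁻¹))/Q_n(t⁻¹) is the Galois conjugate of Y_n. -/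
open Polynomial in
/-- Evaluating a polynomial at `t⁻¹` puts its `n`-th coefficient in degree `-n`. -/
theorem LaurentSeries.coeff_aeval_single_neg_one {K : Type*} [Field K] (p : K[X]) (n : ℕ) :
    (aeval (HahnSeries.single (-1 : ℤ) (1 : K) : LaurentSeries K) p).coeff (-n : ℤ) =
      p.coeff n := by
  induction p using Polynomial.induction_on' with
  | add p q hp hq => simp [hp, hq]
  | monomial m c =>
    rw [aeval_monomial, HahnSeries.single_pow, one_pow, LaurentSeries.algebraMap_apply,
      HahnSeries.C_mul_eq_smul,
      HahnSeries.coeff_smul, HahnSeries.coeff_single, coeff_monomial]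
    by_cases h : m = n
    · simp [h]
    · simp [h, Ne.symm h]

open Polynomial in
/-- Evaluating a polynomial at `t⁻¹` gives a series supported in degrees at least `-deg p`. -/
theorem LaurentSeries.coeff_aeval_single_neg_one_of_lt {K : Type*} [Field K] (p : K[X]) {k : ℤ}
    (hk : k < -p.natDegree) :
    (aeval (HahnSeries.single (-1 : ℤ) (1 : K) : LaurentSeries K) p).coeff k = 0 := by
  obtain ⟨n, rfl⟩ : ∃ n : ℕ, k = -n := ⟨(-k).toNat, by omega⟩
  rw [coeff_aeval_single_neg_one]
  exact coeff_eq_zero_of_natDegree_lt (by omega)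

open Polynomial in
theorem LaurentSeries.aeval_single_neg_one_ne_zero {K : Type*} [Field K] {p : K[X]}
    (hp : p ≠ 0) :
    aeval (HahnSeries.single (-1 : ℤ) (1 : K) : LaurentSeries K) p ≠ 0 := by
  intro h
  have := coeff_aeval_single_neg_one p p.natDegree
  rw [h] at this
  exact leadingCoeff_ne_zero.mpr hp this.symm

open Polynomial in
theorem LaurentSeries.order_aeval_single_neg_one {K : Type*} [Field K] {p : K[X]} (hp : p ≠ 0) :
    (aeval (HahnSeries.single (-1 : ℤ) (1 : K) : LaurentSeries K) p).order = -p.natDegree := by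
  apply le_antisymm
  · apply HahnSeries.order_le_of_coeff_ne_zero
    rw [coeff_aeval_single_neg_one]
    exact leadingCoeff_ne_zero.mpr hp
  · by_contra! h
    exact aeval_single_neg_one_ne_zero hp
      (HahnSeries.coeff_order_eq_zero.mp (coeff_aeval_single_neg_one_of_lt p h))

/-- Lemma A.2 and Theorem A.3 of the paper, general hyperelliptic curves of
genus `g`: the functions `Ỹ_n` satisfy the backward continued-fraction recursion with linear
partial quotients `a_{n−1}`, and `(Y_n, Ỹ_n)` is a quadratic orthogonal pair:
`Ỹ_n · Y_n* = −1`. -/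
theorem genus_g_backward_cf_and_pair
    (g : ℕ) (hg : 1 ≤ g) (u : ℂ) (hu : u ≠ 0)
    (A R : Polynomial ℂ)
    (hA : A.Monic) (hAdeg : A.natDegree = g + 1)
    (hRdeg : R.natDegree = g) (hRlead : R.leadingCoeff = u)
    (hns : ¬ ∃ p : Polynomial ℂ, A ^ 2 + 4 * R = p ^ 2)
    (Y : LaurentSeries ℂ)
    (hY : Y ^ 2 = Polynomial.aeval
      (HahnSeries.single (-1 : ℤ) (1 : ℂ) : LaurentSeries ℂ) (A ^ 2 + 4 * R))
    (hYnorm : ((HahnSeries.single ((g : ℤ) + 1) (1 : ℂ) : LaurentSeries ℂ) * Y).coeff 0 = 1)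
    (P Q : ℤ → Polynomial ℂ) (uu ρ : ℤ → ℂ) (a : ℤ → Polynomial ℂ)
    (hPdeg : ∀ n : ℤ, (P n - A).degree ≤ ((g : ℕ) - 1 : ℕ))
    (hQdeg : ∀ n : ℤ, (Q n).natDegree = g)
    (hQlead : ∀ n : ℤ, (Q n).coeff g = uu n)
    (huu : ∀ n : ℤ, uu n ≠ 0)
    (hρ : ∀ n : ℤ, ρ n = (Q n).coeff (g - 1) / uu n)
    (ha : ∀ n : ℤ, a n = Polynomial.C (2 / uu n) * (Polynomial.X - Polynomial.C (ρ n)))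
    (hPiter : ∀ n : ℤ, P (n + 1) = a n * Q n - P n)
    (hQiter : ∀ n : ℤ, Q (n + 1) = Q (n - 1) + 2 * a n * P n - (a n) ^ 2 * Q n)
    (hcons : ∀ n : ℤ, (P n) ^ 2 + Q n * Q (n - 1) = A ^ 2 + 4 * R)
    (Yseq Ytil Ystar : ℤ → LaurentSeries ℂ)
    (hYseq : ∀ n : ℤ, Yseq n =
      (Y + Polynomial.aeval (HahnSeries.single (-1 : ℤ) (1 : ℂ) : LaurentSeries ℂ) (P n)) /
        Polynomial.aeval (HahnSeries.single (-1 : ℤ) (1 : ℂ) : LaurentSeries ℂ) (Q n))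
    (hYtil : ∀ n : ℤ, Ytil n =
      (Y + Polynomial.aeval (HahnSeries.single (-1 : ℤ) (1 : ℂ) : LaurentSeries ℂ) (P n)) /
        Polynomial.aeval (HahnSeries.single (-1 : ℤ) (1 : ℂ) : LaurentSeries ℂ) (Q (n - 1)))
    (hYstar : ∀ n : ℤ, Ystar n =
      (-Y + Polynomial.aeval (HahnSeries.single (-1 : ℤ) (1 : ℂ) : LaurentSeries ℂ) (P n)) /
        Polynomial.aeval (HahnSeries.single (-1 : ℤ) (1 : ℂ) : LaurentSeries ℂ) (Q n))
    :
    ∀ n : ℤ,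
      (Ytil (n - 1) ≠ 0 ∧
        Ytil n = Polynomial.aeval (HahnSeries.single (-1 : ℤ) (1 : ℂ) : LaurentSeries ℂ)
            (a (n - 1)) + (Ytil (n - 1))⁻¹ ∧
        (∀ k : ℤ, k ≤ 0 →
          (Ytil n - Polynomial.aeval (HahnSeries.single (-1 : ℤ) (1 : ℂ) : LaurentSeries ℂ)
            (a (n - 1))).coeff k = 0)) ∧
      Ytil n * Ystar n = -1 := by
  set φ := Polynomial.aeval (R := ℂ) (HahnSeries.single (-1 : ℤ) (1 : ℂ) : LaurentSeries ℂ)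
    with hφ
  have hQ0 (n : ℤ) : Q n ≠ 0 := by
    intro h
    exact huu n (by rw [← hQlead, h, Polynomial.coeff_zero])
  have hφQ (n : ℤ) : φ (Q n) ≠ 0 := LaurentSeries.aeval_single_neg_one_ne_zero (hQ0 n)
  have hprod (n : ℤ) : (Y + φ (P n)) * (Y - φ (P n)) = φ (Q n) * φ (Q (n - 1)) := by
    have := hY
    rw [← hcons n, map_add, map_pow, map_mul] at this
    linear_combination this
  have hYP (n : ℤ) : Y + φ (P n) ≠ 0 := by
    intro h
    have := hprod n
    rw [h, zero_mul] at this
    exact mul_ne_zero (hφQ n) (hφQ (n - 1)) this.symm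
  have hYcoeff : Y.coeff (-((g + 1 : ℕ) : ℤ)) = 1 := by
    have := HahnSeries.coeff_single_mul_add (r := (1 : ℂ)) (x := Y)
      (a := -((g + 1 : ℕ) : ℤ)) (b := (g : ℤ) + 1)
    rw [one_mul, show -((g + 1 : ℕ) : ℤ) + (g + 1) = 0 by push_cast; ring, hYnorm] at this
    exact this.symm
  have hPcoeff (n : ℤ) : (P n).coeff (g + 1) = 1 := by
    have h1 : (P n - A).coeff (g + 1) = 0 :=
      Polynomial.coeff_eq_zero_of_degree_lt
        ((hPdeg n).trans_lt (by exact_mod_cast (by omega : g - 1 < g + 1)))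
    rw [Polynomial.coeff_sub, ← hAdeg, hA.coeff_natDegree, hAdeg] at h1
    exact sub_eq_zero.mp h1
  have horder (n : ℤ) : (Y + φ (P n)).order ≤ -((g + 1 : ℕ) : ℤ) := by
    apply HahnSeries.order_le_of_coeff_ne_zero
    rw [HahnSeries.coeff_add, hYcoeff, hφ, LaurentSeries.coeff_aeval_single_neg_one, hPcoeff]
    norm_num
  have hYtil0 (n : ℤ) : Ytil n ≠ 0 := by
    rw [hYtil]
    exact div_ne_zero (hYP n) (hφQ _)
  have hinv_order (n : ℤ) : 1 ≤ (Ytil n)⁻¹.order := by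
    have h1 : (Ytil n)⁻¹ * (Y + φ (P n)) = φ (Q (n - 1)) := by
      rw [hYtil, inv_div, div_mul_cancel₀ _ (hYP n)]
    have h2 := congrArg HahnSeries.order h1
    rw [HahnSeries.order_mul (inv_ne_zero (hYtil0 n)) (hYP n),
      LaurentSeries.order_aeval_single_neg_one (hQ0 _), hQdeg] at h2
    have := horder n
    push_cast at this
    omega
  intro n
  have hstep : Ytil n = φ (a (n - 1)) + (Ytil (n - 1))⁻¹ := by
    have hP := congrArg φ (hPiter (n - 1))
    rw [sub_add_cancel, map_sub, map_mul] at hP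
    rw [hYtil n, hYtil (n - 1), inv_div, hP, div_eq_iff (hφQ _), add_mul,
      div_mul_eq_mul_div, mul_comm (φ (Q (n - 1 - 1))), ← hprod (n - 1),
      mul_div_cancel_left₀ _ (hYP _)]
    ring
  refine ⟨⟨hYtil0 _, hstep, fun k hk => ?_⟩, ?_⟩
  · rw [hstep, add_sub_cancel_left]
    exact HahnSeries.coeff_eq_zero_of_lt_order (by have := hinv_order (n - 1); omega)
  · rw [hYtil, hYstar, div_mul_div_comm,
      div_eq_iff (mul_ne_zero (hφQ _) (hφQ _))]
    linear_combination -hprod n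
end
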